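/- For all integers k₁, k, n with 0 ≤ k₁ ≤ k ≤ n/2, one has E_k(n) ≤ E_{k₁}(n − 2(k − k₁)) + 7. -/

import Mathlib

/-- A (binary) decision tree over ground set `[n]` (positions `Fin n`):
leaves are labelled with a Boolean output, inner nodes with a query `i ∈ [n]`;
the left subtree corresponds to the answer `i ∉ A`, the right one to `i ∈ A`. -/
inductive DecTree (n : ℕ) : Type
  | leaf : Bool → DecTree n
  | node : Fin n → DecTree n → DecTree n → DecTree n

namespace DecTree

/-- The height (depth) of a decision tree: the maximum number of queries on a
root-to-leaf path. -/
def depth {n : ℕ} : DecTree n → ℕ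
  | leaf _ => 0
  | node _ t0 t1 => max (depth t0) (depth t1) + 1

/-- Evaluate a decision tree on an input set `A ⊆ [n]`. -/
def eval {n : ℕ} : DecTree n → Finset (Fin n) → Bool
  | leaf b, _ => b
  | node i t0 t1, A => if i ∈ A then eval t1 A else eval t0 A

end DecTree

/-- The slice: the `k`-element subsets of `[n]`. -/
def Slice (n k : ℕ) : Type := {A : Finset (Fin n) // A.card = k}

/-- A decision tree computes `f` on the slice if it evaluates to `f A` for every
`A` in the slice. -/
def Computes {n k : ℕ} (T : DecTree n) (f : Slice n k → Bool) : Prop :=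
  ∀ A : Slice n k, T.eval A.val = f A

/-- Deterministic query complexity of `f` on the slice: the minimum height of a
decision tree computing `f`. -/
noncomputable def Dquery (n k : ℕ) (f : Slice n k → Bool) : ℕ :=
  sInf {d : ℕ | ∃ T : DecTree n, T.depth ≤ d ∧ Computes T f}

/-- `Dmax n k`: the maximum deterministic query complexity over all Boolean
functions on the slice of `k`-subsets of `[n]`. -/
noncomputable def Dmax (n k : ℕ) : ℕ :=
  sSup {d : ℕ | ∃ f : Slice n k → Bool, Dquery n k f = d}

/-- `Equery n k = n - Dmax n k`. -/
noncomputable def Equery (n k : ℕ) : ℕ := n - Dmax n k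

namespace DecTree

theorem exists_eval_inter {n : ℕ} (U : Finset (Fin n)) (f : Finset (Fin n) → Bool) :
    ∃ T : DecTree n, ∀ A, T.eval A = f (A ∩ U) := by
  induction U using Finset.induction_on generalizing f with
  | empty => exact ⟨leaf (f ∅), fun A => by simp [eval]⟩
  | insert i U hi ih =>
    obtain ⟨T0, h0⟩ := ih f
    obtain ⟨T1, h1⟩ := ih fun A => f (insert i A)
    refine ⟨node i T0 T1, fun A => ?_⟩
    by_cases hA : i ∈ A
    · simp [eval, hA, h1, Finset.inter_insert_of_mem]
    · simp [eval, hA, h0, Finset.inter_insert_of_notMem]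

/-- The union of `A` and `B` inside the disjoint union of the two ground sets. -/
def join {a b : ℕ} (A : Finset (Fin a)) (B : Finset (Fin b)) : Finset (Fin (a + b)) :=
  A.map (Fin.castAddEmb b) ∪ B.map (Fin.natAddEmb a)

theorem castAdd_mem_join {a b : ℕ} {A : Finset (Fin a)} {B : Finset (Fin b)} {i : Fin a} :
    Fin.castAdd b i ∈ join A B ↔ i ∈ A := by
  simp only [join, Finset.mem_union, Finset.mem_map, Fin.castAddEmb_apply, Fin.natAddEmb_apply,
    Fin.ext_iff, Fin.val_castAdd, Fin.val_natAdd]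
  constructor
  · rintro (⟨j, hj, h⟩ | ⟨j, hj, h⟩)
    · rwa [← Fin.ext h]
    · omega
  · exact fun h => Or.inl ⟨i, h, rfl⟩

theorem natAdd_mem_join {a b : ℕ} {A : Finset (Fin a)} {B : Finset (Fin b)} {i : Fin b} :
    Fin.natAdd a i ∈ join A B ↔ i ∈ B := by
  simp only [join, Finset.mem_union, Finset.mem_map, Fin.castAddEmb_apply, Fin.natAddEmb_apply,
    Fin.ext_iff, Fin.val_castAdd, Fin.val_natAdd]
  constructor
  · rintro (⟨j, hj, h⟩ | ⟨j, hj, h⟩)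
    · omega
    · rwa [← Fin.ext (show (j : ℕ) = i by omega)]
  · exact fun h => Or.inr ⟨i, h, rfl⟩

theorem card_join {a b : ℕ} (A : Finset (Fin a)) (B : Finset (Fin b)) :
    (join A B).card = A.card + B.card := by
  rw [join, Finset.card_union_of_disjoint, Finset.card_map, Finset.card_map]
  rw [Finset.disjoint_left]
  simp only [Finset.mem_map, Fin.castAddEmb_apply, Fin.natAddEmb_apply]
  rintro x ⟨i, -, rfl⟩ ⟨j, -, h⟩
  simp only [Fin.ext_iff, Fin.val_castAdd, Fin.val_natAdd] at h
  omega

/-- A tree computing `f A ⊕ g B` splits into trees for `f` and `g` of no larger total depth. -/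
theorem exists_split_xor {a b : ℕ} (T : DecTree (a + b)) (f : Finset (Fin a) → Bool)
    (g : Finset (Fin b) → Bool) (P : Set (Finset (Fin a))) (Q : Set (Finset (Fin b)))
    (hP : P.Nonempty) (hQ : Q.Nonempty)
    (h : ∀ A ∈ P, ∀ B ∈ Q, T.eval (join A B) = (f A ^^ g B)) :
    ∃ (T₁ : DecTree a) (T₂ : DecTree b), T₁.depth + T₂.depth ≤ T.depth ∧
      (∀ A ∈ P, T₁.eval A = f A) ∧ ∀ B ∈ Q, T₂.eval B = g B := by
  induction T generalizing P Q with
  | leaf c =>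
    obtain ⟨A₀, hA₀⟩ := hP
    obtain ⟨B₀, hB₀⟩ := hQ
    refine ⟨leaf (f A₀), leaf (g B₀), by simp [depth], fun A hA => ?_, fun B hB => ?_⟩
    · have h1 := h A₀ hA₀ B₀ hB₀
      have h2 := h A hA B₀ hB₀
      simp only [eval] at h1 h2 ⊢
      rw [h1] at h2
      exact Bool.xor_left_inj.mp h2
    · have h1 := h A₀ hA₀ B₀ hB₀
      have h2 := h A₀ hA₀ B hB
      simp only [eval] at h1 h2 ⊢
      rw [h1] at h2
      exact Bool.xor_right_inj.mp h2
  | node i t0 t1 ih0 ih1 =>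
    induction i using Fin.addCases with
    | left i =>
      simp only [eval, castAdd_mem_join] at h
      by_cases hP0 : {A ∈ P | i ∉ A}.Nonempty
      · by_cases hP1 : {A ∈ P | i ∈ A}.Nonempty
        · obtain ⟨R0, S0, hd0, hR0, hS0⟩ := ih0 _ Q hP0 hQ fun A hA B hB => by
            simpa [hA.2] using h A hA.1 B hB
          obtain ⟨R1, S1, hd1, hR1, hS1⟩ := ih1 _ Q hP1 hQ fun A hA B hB => by
            simpa [hA.2] using h A hA.1 B hB
          have hR : ∀ A ∈ P, (node i R0 R1).eval A = f A := fun A hA => by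
            by_cases hi : i ∈ A
            · simpa [eval, hi] using hR1 A ⟨hA, hi⟩
            · simpa [eval, hi] using hR0 A ⟨hA, hi⟩
          rcases le_total S0.depth S1.depth with hS | hS
          · exact ⟨_, S0, by simp only [depth]; omega, hR, hS0⟩
          · exact ⟨_, S1, by simp only [depth]; omega, hR, hS1⟩
        · have hi : ∀ A ∈ P, i ∉ A := fun A hA hi => hP1 ⟨A, hA, hi⟩
          obtain ⟨R, S, hd, hR, hS⟩ := ih0 P Q hP hQ fun A hA B hB => by
            simpa [hi A hA] using h A hA B hB
          exact ⟨R, S, by simp only [depth]; omega, hR, hS⟩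
      · have hi : ∀ A ∈ P, i ∈ A := fun A hA => by_contra fun hi => hP0 ⟨A, hA, hi⟩
        obtain ⟨R, S, hd, hR, hS⟩ := ih1 P Q hP hQ fun A hA B hB => by
          simpa [hi A hA] using h A hA B hB
        exact ⟨R, S, by simp only [depth]; omega, hR, hS⟩
    | right i =>
      simp only [eval, natAdd_mem_join] at h
      by_cases hQ0 : {B ∈ Q | i ∉ B}.Nonempty
      · by_cases hQ1 : {B ∈ Q | i ∈ B}.Nonempty
        · obtain ⟨R0, S0, hd0, hR0, hS0⟩ := ih0 P _ hP hQ0 fun A hA B hB => by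
            simpa [hB.2] using h A hA B hB.1
          obtain ⟨R1, S1, hd1, hR1, hS1⟩ := ih1 P _ hP hQ1 fun A hA B hB => by
            simpa [hB.2] using h A hA B hB.1
          have hS : ∀ B ∈ Q, (node i S0 S1).eval B = g B := fun B hB => by
            by_cases hi : i ∈ B
            · simpa [eval, hi] using hS1 B ⟨hB, hi⟩
            · simpa [eval, hi] using hS0 B ⟨hB, hi⟩
          rcases le_total R0.depth R1.depth with hR | hR
          · exact ⟨R0, _, by simp only [depth]; omega, hR0, hS⟩
          · exact ⟨R1, _, by simp only [depth]; omega, hR1, hS⟩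
        · have hi : ∀ B ∈ Q, i ∉ B := fun B hB hi => hQ1 ⟨B, hB, hi⟩
          obtain ⟨R, S, hd, hR, hS⟩ := ih0 P Q hP hQ fun A hA B hB => by
            simpa [hi B hB] using h A hA B hB
          exact ⟨R, S, by simp only [depth]; omega, hR, hS⟩
      · have hi : ∀ B ∈ Q, i ∈ B := fun B hB => by_contra fun hi => hQ0 ⟨B, hB, hi⟩
        obtain ⟨R, S, hd, hR, hS⟩ := ih1 P Q hP hQ fun A hA B hB => by
          simpa [hi B hB] using h A hA B hB
        exact ⟨R, S, by simp only [depth]; omega, hR, hS⟩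

/-- Some tree of depth at most `d` computes `f` on the sets `I ∪ B`, where `B` ranges over the
`w`-element subsets of the free set `U`. -/
def Solvable {n : ℕ} (d w : ℕ) (U I : Finset (Fin n)) (f : Finset (Fin n) → Bool) : Prop :=
  ∃ T : DecTree n, T.depth ≤ d ∧ ∀ B ⊆ U, B.card = w → T.eval (I ∪ B) = f (I ∪ B)

theorem Solvable.congr {n d w : ℕ} {U I : Finset (Fin n)} {f g : Finset (Fin n) → Bool}
    (h : Solvable d w U I f) (hfg : ∀ B ⊆ U, f (I ∪ B) = g (I ∪ B)) : Solvable d w U I g := by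
  obtain ⟨T, hd, hT⟩ := h
  exact ⟨T, hd, fun B hB hw => (hT B hB hw).trans (hfg B hB)⟩

theorem Solvable.exists_const {n w : ℕ} {U I : Finset (Fin n)} {f : Finset (Fin n) → Bool}
    (h : Solvable 0 w U I f) : ∃ c, ∀ B ⊆ U, B.card = w → f (I ∪ B) = c := by
  obtain ⟨T, hd, hT⟩ := h
  cases T with
  | leaf c => exact ⟨c, fun B hB hw => (hT B hB hw).symm⟩
  | node i t0 t1 => simp [depth] at hd

/-- The first query of a tree can be taken to be a free element. -/
theorem Solvable.exists_query {n d w : ℕ} {U I : Finset (Fin n)} {f : Finset (Fin n) → Bool}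
    (hU : U.Nonempty) (hUI : Disjoint U I) (h : Solvable (d + 1) (w + 1) U I f) :
    ∃ i ∈ U, Solvable d w (U.erase i) (insert i I) f ∧
      Solvable d (w + 1) (U.erase i) I f := by
  obtain ⟨T, hd, hT⟩ := h
  have key : ∀ i ∈ U, ∀ B ⊆ U.erase i, insert i B ⊆ U ∧ (insert i B).card = B.card + 1 ∧
      insert i I ∪ B = I ∪ insert i B := fun i hi B hB =>
    ⟨Finset.insert_subset hi (hB.trans (Finset.erase_subset _ _)),
      Finset.card_insert_of_notMem fun h => Finset.notMem_erase i U (hB h),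
      by rw [Finset.insert_union, Finset.union_insert]⟩
  induction T with
  | leaf c =>
    obtain ⟨i, hi⟩ := hU
    refine ⟨i, hi, ⟨leaf c, by simp [depth], fun B hB hw => ?_⟩,
      ⟨leaf c, by simp [depth], fun B hB hw => ?_⟩⟩
    · obtain ⟨h1, h2, h3⟩ := key i hi B hB
      rw [h3]
      exact hT _ h1 (by omega)
    · exact hT B (hB.trans (Finset.erase_subset _ _)) hw
  | node i t0 t1 ih0 ih1 =>
    simp only [depth] at hd
    simp only [eval, Finset.mem_union] at hT
    by_cases hi : i ∈ U
    · refine ⟨i, hi, ⟨t1, by omega, fun B hB hw => ?_⟩, ⟨t0, by omega, fun B hB hw => ?_⟩⟩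
      · obtain ⟨h1, h2, h3⟩ := key i hi B hB
        rw [h3]
        simpa using hT _ h1 (by omega)
      · have hI : i ∉ I := Finset.disjoint_left.mp hUI hi
        have hB' : i ∉ B := fun h => Finset.notMem_erase i U (hB h)
        simpa [hI, hB'] using hT B (hB.trans (Finset.erase_subset _ _)) hw
    · by_cases hI : i ∈ I
      · exact ih1 (by omega) fun B hB hw => by simpa [hI] using hT B hB hw
      · refine ih0 (by omega) fun B hB hw => ?_
        have hB' : i ∉ B := fun h => hi (hB h)
        simpa [hI, hB'] using hT B hB hw

/-- Two queries answered differently. -/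
theorem Solvable.exists_two_queries {n d w : ℕ} {U I : Finset (Fin n)}
    {f : Finset (Fin n) → Bool} (hU : 2 ≤ U.card) (hUI : Disjoint U I)
    (h : Solvable (d + 2) (w + 2) U I f) :
    ∃ i ∈ U, ∃ p ∈ U.erase i, ∃ q ∈ U.erase i,
      Solvable d (w + 1) ((U.erase i).erase p) (insert i I) f ∧
      Solvable d (w + 1) ((U.erase i).erase q) (insert q I) f := by
  obtain ⟨i, hi, h1, h0⟩ := h.exists_query (Finset.card_pos.mp (by omega)) hUI
  have hne : (U.erase i).Nonempty :=
    Finset.card_pos.mp (by rw [Finset.card_erase_of_mem hi]; omega)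
  have hd0 : Disjoint (U.erase i) I := hUI.mono_left (Finset.erase_subset _ _)
  have hd1 : Disjoint (U.erase i) (insert i I) := by
    rw [Finset.disjoint_insert_right]
    exact ⟨Finset.notMem_erase i U, hd0⟩
  obtain ⟨p, hp, -, hp0⟩ := h1.exists_query hne hd1
  obtain ⟨q, hq, hq1, -⟩ := h0.exists_query hne hd0
  exact ⟨i, hi, p, hp, q, hq, hp0, hq1⟩

end DecTree

section Counting

variable {α : Type*} [Fintype α] [DecidableEq α]

open Classical in
/-- Events depending on complementary sets of coordinates are independent. -/
theorem card_filter_and_mul_card (S : Set α) (P Q : (α → Bool) → Prop)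
    (hP : ∀ f g, (∀ x ∈ S, f x = g x) → P f → P g)
    (hQ : ∀ f g, (∀ x ∉ S, f x = g x) → Q f → Q g) :
    (Finset.univ.filter fun f => P f ∧ Q f).card * Fintype.card (α → Bool) =
      (Finset.univ.filter P).card * (Finset.univ.filter Q).card := by
  rw [← Finset.card_univ, ← Finset.card_product, ← Finset.card_product]
  let φ : (α → Bool) × (α → Bool) → (α → Bool) × (α → Bool) :=
    fun x => (S.piecewise x.1 x.2, S.piecewise x.2 x.1)
  have hφ : ∀ x, φ (φ x) = x := fun x => by
    ext a <;> by_cases ha : a ∈ S <;> simp [φ, ha]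
  refine Finset.card_nbij' φ φ ?_ ?_ (fun x _ => hφ x) fun x _ => hφ x
  · rintro ⟨f, g⟩ h
    simp only [Finset.coe_product, Finset.coe_filter, Finset.mem_univ, true_and, Finset.coe_univ,
      Set.mem_prod, Set.mem_ofPred_eq, Set.mem_univ, and_true, φ] at h ⊢
    exact ⟨hP f _ (fun x hx => by simp [hx]) h.1, hQ f _ (fun x hx => by simp [hx]) h.2⟩
  · rintro ⟨f, g⟩ h
    simp only [Finset.coe_product, Finset.coe_filter, Finset.mem_univ, true_and, Finset.coe_univ,
      Set.mem_prod, Set.mem_ofPred_eq, Set.mem_univ, and_true, φ] at h ⊢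
    exact ⟨hP f _ (fun x hx => by simp [hx]) h.1, hQ g _ (fun x hx => by simp [hx]) h.2⟩

theorem two_pow_mul_card_filter_const_le (S : Finset α) (c : Bool) :
    2 ^ S.card * (Finset.univ.filter fun f : α → Bool => ∀ x ∈ S, f x = c).card ≤
      Fintype.card (α → Bool) := by
  rw [← Finset.card_powerset, ← Finset.card_product, ← Finset.card_univ]
  refine Finset.card_le_card_of_injOn (fun x a => x.2 a ^^ decide (a ∈ x.1)) (by simp) ?_
  rintro ⟨s, f⟩ h ⟨t, g⟩ h' hfg
  simp only [Finset.coe_product, Finset.coe_filter, Finset.mem_univ, true_and,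
    Set.mem_prod, Set.mem_ofPred_eq, Finset.mem_coe, Finset.mem_powerset] at h h'
  have hst : s = t := by
    ext a
    by_cases ha : a ∈ S
    · have := congrFun hfg a
      simpa [h.2 a ha, h'.2 a ha] using this
    · exact iff_of_false (fun hs => ha (h.1 hs)) fun ht => ha (h'.1 ht)
  subst hst
  have : f = g := funext fun a => by simpa using congrFun hfg a
  rw [this]

end Counting

namespace DecTree

open Classical in
theorem card_solvable_zero_le {n : ℕ} (U I : Finset (Fin n)) (hU : U.card = 6)
    (hUI : Disjoint U I) :
    1000 * (Finset.univ.filter (Solvable 0 3 U I)).card ≤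
      Fintype.card (Finset (Fin n) → Bool) := by
  let S : Finset (Finset (Fin n)) := (U.powersetCard 3).image (I ∪ ·)
  have hS : S.card = 20 := by
    rw [Finset.card_image_of_injOn, Finset.card_powersetCard, hU]
    · rfl
    · intro B hB C hC h
      simp only [Finset.mem_coe, Finset.mem_powersetCard] at hB hC
      have hB' : Disjoint I B := (hUI.mono_left hB.1).symm
      have hC' : Disjoint I C := (hUI.mono_left hC.1).symm
      rw [← Finset.union_sdiff_cancel_left hB', ← Finset.union_sdiff_cancel_left hC']
      exact congrArg (· \ I) h
  have hsub : Finset.univ.filter (Solvable 0 3 U I) ⊆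
      (Finset.univ.filter fun f : Finset (Fin n) → Bool => ∀ x ∈ S, f x = true) ∪
      Finset.univ.filter fun f : Finset (Fin n) → Bool => ∀ x ∈ S, f x = false := by
    intro f hf
    obtain ⟨c, hc⟩ := (Finset.mem_filter.mp hf).2.exists_const
    have hc' : ∀ x ∈ S, f x = c := fun x hx => by
      obtain ⟨B, hB, rfl⟩ := Finset.mem_image.mp hx
      rw [Finset.mem_powersetCard] at hB
      exact hc B hB.1 hB.2
    cases c with
    | true => exact Finset.mem_union_left _ (Finset.mem_filter.mpr ⟨Finset.mem_univ _, hc'⟩)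
    | false => exact Finset.mem_union_right _ (Finset.mem_filter.mpr ⟨Finset.mem_univ _, hc'⟩)
  have h := (Finset.card_le_card hsub).trans (Finset.card_union_le _ _)
  have ht := two_pow_mul_card_filter_const_le S true
  have hf := two_pow_mul_card_filter_const_le S false
  rw [hS] at ht hf
  omega

open Classical in
theorem card_solvable_le {n : ℕ} (j : ℕ) (U I : Finset (Fin n)) (hU : U.card = 2 * j + 6)
    (hUI : Disjoint U I) :
    ((Finset.univ.filter (Solvable (2 * j) (j + 3) U I)).card : ℚ) ≤
      Fintype.card (Finset (Fin n) → Bool) / (2 * j + 10) ^ 3 := by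
  set M : ℕ := Fintype.card (Finset (Fin n) → Bool) with hM
  have hMpos : (0 : ℚ) < M := by exact_mod_cast Fintype.card_pos
  induction j generalizing U I with
  | zero =>
    have h := card_solvable_zero_le U I hU hUI
    have h' : (1000 : ℚ) * (Finset.univ.filter (Solvable 0 3 U I)).card ≤ M := by exact_mod_cast h
    rw [le_div_iff₀ (by positivity)]
    norm_num
    linarith
  | succ j ih =>
    let E (i p q : Fin n) : Finset (Finset (Fin n) → Bool) := Finset.univ.filter fun f =>
      Solvable (2 * j) (j + 3) ((U.erase i).erase p) (insert i I) f ∧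
      Solvable (2 * j) (j + 3) ((U.erase i).erase q) (insert q I) f
    have hsub : Finset.univ.filter (Solvable (2 * (j + 1)) (j + 1 + 3) U I) ⊆
        U.biUnion fun i => (U.erase i).biUnion fun p => (U.erase i).biUnion fun q => E i p q := by
      intro f hf
      obtain ⟨i, hi, p, hp, q, hq, h⟩ :=
        Solvable.exists_two_queries (d := 2 * j) (w := j + 2) (by omega) hUI
          (Finset.mem_filter.mp hf).2
      simp only [Finset.mem_biUnion]
      exact ⟨i, hi, p, hp, q, hq, Finset.mem_filter.mpr ⟨Finset.mem_univ _, h⟩⟩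
    have hE : ∀ i ∈ U, ∀ p ∈ U.erase i, ∀ q ∈ U.erase i,
        ((E i p q).card : ℚ) ≤ M / (2 * j + 10) ^ 6 := by
      intro i hi p hp q hq
      have hcard : ∀ r ∈ U.erase i, ((U.erase i).erase r).card = 2 * j + 6 := fun r hr => by
        rw [Finset.card_erase_of_mem hr, Finset.card_erase_of_mem hi]
        omega
      have hdis : ∀ r, Disjoint ((U.erase i).erase r) I := fun r =>
        hUI.mono_left ((Finset.erase_subset _ _).trans (Finset.erase_subset _ _))
      have h1 := ih ((U.erase i).erase p) (insert i I) (hcard p hp)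
        (by simp [Finset.disjoint_insert_right, hdis])
      have h2 := ih ((U.erase i).erase q) (insert q I) (hcard q hq)
        (by simp [Finset.disjoint_insert_right, hdis])
      have hind := card_filter_and_mul_card {A : Finset (Fin n) | i ∈ A}
        (Solvable (2 * j) (j + 3) ((U.erase i).erase p) (insert i I))
        (Solvable (2 * j) (j + 3) ((U.erase i).erase q) (insert q I))
        (fun f g hfg h => h.congr fun B _ => hfg _ (by simp))
        (fun f g hfg h => h.congr fun B hB => hfg _ (by
          have hiI : i ∉ I := Finset.disjoint_left.mp hUI hi
          have hiq : i ≠ q := (Finset.ne_of_mem_erase hq).symm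
          have hiB : i ∉ B := fun h => by simpa using hB h
          simp [hiI, hiq, hiB]))
      have hind' := congrArg (Nat.cast (R := ℚ)) hind
      rw [Nat.cast_mul, Nat.cast_mul, ← hM] at hind'
      refine le_of_mul_le_mul_right (hind'.trans_le
        ((mul_le_mul h1 h2 (by positivity) (by positivity)).trans_eq ?_)) hMpos
      field_simp
    have hcardE : ∀ i ∈ U, (U.erase i).card = 2 * j + 7 := fun i hi => by
      rw [Finset.card_erase_of_mem hi]
      omega
    have hle : ((Finset.univ.filter (Solvable (2 * (j + 1)) (j + 1 + 3) U I)).card : ℚ) ≤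
        ∑ i ∈ U, ∑ p ∈ U.erase i, ∑ q ∈ U.erase i, ((E i p q).card : ℚ) := by
      refine (Nat.cast_le.mpr (Finset.card_le_card hsub)).trans ?_
      exact_mod_cast Finset.card_biUnion_le.trans (Finset.sum_le_sum fun i _ =>
        Finset.card_biUnion_le.trans (Finset.sum_le_sum fun p _ => Finset.card_biUnion_le))
    have hsum : ∑ i ∈ U, ∑ p ∈ U.erase i, ∑ q ∈ U.erase i, ((E i p q).card : ℚ) ≤
        ∑ i ∈ U, ∑ p ∈ U.erase i, ∑ q ∈ U.erase i, ((M : ℚ) / (2 * j + 10) ^ 6 : ℚ) :=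
      Finset.sum_le_sum fun i hi => Finset.sum_le_sum fun p hp => Finset.sum_le_sum fun q hq =>
        hE i hi p hp q hq
    have heq : ∑ i ∈ U, ∑ p ∈ U.erase i, ∑ q ∈ U.erase i, ((M : ℚ) / (2 * j + 10) ^ 6 : ℚ) =
        (2 * j + 8) * ((2 * j + 7) * ((2 * j + 7) * ((M : ℚ) / (2 * j + 10) ^ 6))) := by
      simp only [Finset.sum_const, nsmul_eq_mul]
      rw [Finset.sum_congr rfl fun i hi => by rw [hcardE i hi], Finset.sum_const, hU, nsmul_eq_mul]
      push_cast
      ring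
    refine (hle.trans (hsum.trans_eq heq)).trans ?_
    have hj : (0 : ℚ) ≤ j := Nat.cast_nonneg j
    have h1 : ((2 : ℚ) * j + 8) * ((2 * j + 7) * (2 * j + 7)) ≤ (2 * j + 8) ^ 3 := by nlinarith
    have h2 := pow_le_pow_left₀ (a := ((2 : ℚ) * j + 8) * (2 * j + 12)) (b := (2 * j + 10) ^ 2)
      (by positivity) (by nlinarith) 3
    rw [mul_pow, ← pow_mul] at h2
    have h3 : ((2 : ℚ) * j + 8) * ((2 * j + 7) * (2 * j + 7)) * (2 * j + 12) ^ 3 ≤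
        (2 * j + 10) ^ 6 :=
      (mul_le_mul_of_nonneg_right h1 (by positivity)).trans h2
    push_cast
    rw [show (2 : ℚ) * (j + 1) + 10 = 2 * j + 12 by ring, le_div_iff₀ (by positivity),
      show (2 * (j : ℚ) + 8) * ((2 * j + 7) * ((2 * j + 7) * (M / (2 * j + 10) ^ 6))) *
        (2 * j + 12) ^ 3 = ((2 * j + 8) * ((2 * j + 7) * (2 * j + 7)) * (2 * j + 12) ^ 3) * M /
        (2 * j + 10) ^ 6 by ring, div_le_iff₀ (by positivity), mul_comm (M : ℚ)]
    exact mul_le_mul_of_nonneg_right h3 hMpos.le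

theorem exists_not_solvable (j : ℕ) :
    ∃ f : Finset (Fin (2 * (j + 3))) → Bool, ¬ Solvable (2 * j) (j + 3) Finset.univ ∅ f := by
  classical
  by_contra! h
  have hle := card_solvable_le j (Finset.univ : Finset (Fin (2 * (j + 3)))) ∅
    (by rw [Finset.card_fin]; ring) (Finset.disjoint_empty_right _)
  rw [Finset.filter_true_of_mem fun f _ => h f, Finset.card_univ] at hle
  have hpos : (0 : ℚ) < Fintype.card (Finset (Fin (2 * (j + 3))) → Bool) := by
    exact_mod_cast Fintype.card_pos
  have h1 : (1 : ℚ) < (2 * j + 10) ^ 3 :=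
    one_lt_pow₀ (by have : (0 : ℚ) ≤ j := Nat.cast_nonneg j
                    linarith) (by norm_num)
  exact absurd hle (not_le.mpr (div_lt_self hpos h1))

end DecTree

theorem exists_computes_depth_le_Dquery {n k : ℕ} (f : Slice n k → Bool) :
    ∃ T : DecTree n, T.depth ≤ Dquery n k f ∧ Computes T f := by
  classical
  refine Nat.sInf_mem (s := {d | ∃ T : DecTree n, T.depth ≤ d ∧ Computes T f}) ?_
  obtain ⟨T, hT⟩ := DecTree.exists_eval_inter Finset.univ
    fun A => if h : A.card = k then f ⟨A, h⟩ else false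
  exact ⟨T.depth, T, le_rfl, fun A => by simp [hT, A.property]; rfl⟩

theorem Dquery_le_of_computes {n k : ℕ} {f : Slice n k → Bool} {T : DecTree n}
    (h : Computes T f) : Dquery n k f ≤ T.depth :=
  Nat.sInf_le ⟨T, le_rfl, h⟩

theorem bddAbove_Dquery (n k : ℕ) : BddAbove {d : ℕ | ∃ f : Slice n k → Bool, Dquery n k f = d} :=
  have : Finite (Slice n k) := inferInstanceAs (Finite {A : Finset (Fin n) // A.card = k})
  (Set.finite_range fun f : Slice n k → Bool => Dquery n k f).bddAbove

theorem Dquery_le_Dmax {n k : ℕ} (f : Slice n k → Bool) : Dquery n k f ≤ Dmax n k :=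
  le_csSup (bddAbove_Dquery n k) ⟨f, rfl⟩

theorem exists_Dquery_eq_Dmax (n k : ℕ) : ∃ f : Slice n k → Bool, Dquery n k f = Dmax n k :=
  Nat.sSup_mem (s := {d | ∃ f : Slice n k → Bool, Dquery n k f = d}) ⟨_, fun _ => false, rfl⟩
    (bddAbove_Dquery n k)

theorem exists_extension {n k : ℕ} (f : Slice n k → Bool) :
    ∃ g : Finset (Fin n) → Bool, ∀ A : Slice n k, g A.val = f A := by
  classical
  exact ⟨fun A => if h : A.card = k then f ⟨A, h⟩ else false, fun A => by simp [A.property]; rfl⟩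

theorem Dmax_add_le {a b p q : ℕ} (hp : p ≤ a) (hq : q ≤ b) :
    Dmax a p + Dmax b q ≤ Dmax (a + b) (p + q) := by
  obtain ⟨f, hf⟩ := exists_Dquery_eq_Dmax a p
  obtain ⟨g, hg⟩ := exists_Dquery_eq_Dmax b q
  obtain ⟨f', hf'⟩ := exists_extension f
  obtain ⟨g', hg'⟩ := exists_extension g
  let F : Slice (a + b) (p + q) → Bool := fun S =>
    f' (Finset.univ.filter fun i => Fin.castAdd b i ∈ S.val) ^^
      g' (Finset.univ.filter fun i => Fin.natAdd a i ∈ S.val)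
  obtain ⟨T, hd, hT⟩ := exists_computes_depth_le_Dquery F
  obtain ⟨A, -, hA⟩ := Finset.exists_subset_card_eq (s := (Finset.univ : Finset (Fin a)))
    (n := p) (by simpa using hp)
  obtain ⟨B, -, hB⟩ := Finset.exists_subset_card_eq (s := (Finset.univ : Finset (Fin b)))
    (n := q) (by simpa using hq)
  obtain ⟨T₁, T₂, hle, h₁, h₂⟩ := T.exists_split_xor f' g' {A | A.card = p} {B | B.card = q}
    ⟨A, hA⟩ ⟨B, hB⟩ fun A hA B hB => by
      have hAB : (DecTree.join A B).card = p + q := by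
        rw [DecTree.card_join]
        exact congrArg₂ (· + ·) hA hB
      rw [hT ⟨DecTree.join A B, hAB⟩]
      simp [F, DecTree.castAdd_mem_join, DecTree.natAdd_mem_join]
  have hf₁ : Dquery a p f ≤ T₁.depth :=
    Dquery_le_of_computes fun A => (h₁ A.val A.property).trans (hf' A)
  have hg₂ : Dquery b q g ≤ T₂.depth :=
    Dquery_le_of_computes fun B => (h₂ B.val B.property).trans (hg' B)
  have := Dquery_le_Dmax F
  omega

/-- On the balanced slice some function needs all but at most five queries. -/
theorem two_mul_le_Dmax_add_five (m : ℕ) : 2 * m ≤ Dmax (2 * m) m + 5 := by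
  rcases lt_or_ge m 3 with hm | hm
  · omega
  obtain ⟨j, rfl⟩ := Nat.exists_eq_add_of_le' hm
  obtain ⟨f, hf⟩ := DecTree.exists_not_solvable j
  obtain ⟨T, hd, hT⟩ := exists_computes_depth_le_Dquery
    fun A : Slice (2 * (j + 3)) (j + 3) => f A.val
  have hlt : 2 * j < T.depth := by
    by_contra! hle
    refine hf ⟨T, hle, fun B _ hB => ?_⟩
    rw [Finset.empty_union]
    exact hT ⟨B, hB⟩
  have := Dquery_le_Dmax fun A : Slice (2 * (j + 3)) (j + 3) => f A.val
  omega

/-- For all `0 ≤ k₁ ≤ k ≤ n/2`, one has `E_k(n) ≤ E_{k₁}(n - 2(k - k₁)) + 7`. -/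
theorem stmt_4 (k₁ k n : ℕ) (h₁ : k₁ ≤ k) (h₂ : 2 * k ≤ n) :
    Equery n k ≤ Equery (n - 2 * (k - k₁)) k₁ + 7 := by
  obtain ⟨m, rfl⟩ := Nat.exists_eq_add_of_le h₁
  obtain ⟨a, rfl⟩ := Nat.exists_eq_add_of_le' (show 2 * m ≤ n by omega)
  have h := Dmax_add_le (a := a) (b := 2 * m) (p := k₁) (q := m) (by omega) (by omega)
  have hm := two_mul_le_Dmax_add_five m
  rw [Nat.add_sub_cancel_left, Nat.add_sub_cancel]
  unfold Equery
  omega
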